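/- Let A be a real m×n matrix, B a real m×p matrix, I≤ and I= disjoint sets of row indices with I≤ ∪ I= = {1,…,m}, and suppose the feasible region Ω = {X ∈ ℝ^{n×p} : (AX)_{ij} ≤ B_{ij} for all i ∈ I≤ and all j, and (AX)_{ij} = B_{ij} for all i ∈ I= and all j} is nonempty. Let τ ⊆ I≤ be a set of row indices with ‖A_τ‖_F > 0, let t ≥ 0, and set X⁺ = X − (t/‖A_τ‖_F²)·A_τᵀ(A_τX − B_τ)_+ for a given X ∈ ℝ^{n×p}. Then d(X⁺, Ω)² ≤ d(X, Ω)² − (2t/‖A_τ‖_F²)·(1 − t/2)·‖(A_τX − B_τ)_+‖_F². -/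

import Mathlib

open Finset

/-- Frobenius norm of a real matrix. -/
noncomputable def frob {a b : ℕ} (M : Matrix (Fin a) (Fin b) ℝ) : ℝ :=
  Real.sqrt (∑ i, ∑ j, (M i j) ^ 2)

/-- Distance (w.r.t. Frobenius norm) of a matrix to a set of matrices. -/
noncomputable def mdist {a b : ℕ} (X : Matrix (Fin a) (Fin b) ℝ)
    (Ω : Set (Matrix (Fin a) (Fin b) ℝ)) : ℝ :=
  sInf ((fun Y => frob (X - Y)) '' Ω)

lemma frob_sq {a b : ℕ} (M : Matrix (Fin a) (Fin b) ℝ) :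
    frob M ^ 2 = ∑ i, ∑ j, (M i j) ^ 2 :=
  Real.sq_sqrt (by positivity)

lemma frob_nonneg {a b : ℕ} (M : Matrix (Fin a) (Fin b) ℝ) : 0 ≤ frob M :=
  Real.sqrt_nonneg _

lemma mdist_nonneg {a b : ℕ} (X : Matrix (Fin a) (Fin b) ℝ)
    (Ω : Set (Matrix (Fin a) (Fin b) ℝ)) : 0 ≤ mdist X Ω :=
  Real.sInf_nonneg (by rintro _ ⟨Y, -, rfl⟩; exact frob_nonneg _)

lemma mdist_le_frob {a b : ℕ} (X : Matrix (Fin a) (Fin b) ℝ)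
    {Ω : Set (Matrix (Fin a) (Fin b) ℝ)} {Y : Matrix (Fin a) (Fin b) ℝ} (hY : Y ∈ Ω) :
    mdist X Ω ≤ frob (X - Y) :=
  csInf_le ⟨0, by rintro _ ⟨Z, -, rfl⟩; exact frob_nonneg _⟩ ⟨Y, hY, rfl⟩

lemma le_mdist_sq {a b : ℕ} (X : Matrix (Fin a) (Fin b) ℝ)
    {Ω : Set (Matrix (Fin a) (Fin b) ℝ)} (hne : Ω.Nonempty) {c : ℝ}
    (h : ∀ Y ∈ Ω, c ≤ frob (X - Y) ^ 2) : c ≤ mdist X Ω ^ 2 := by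
  rw [← Real.sqrt_le_left (mdist_nonneg X Ω)]
  refine le_csInf (hne.image _) ?_
  rintro _ ⟨Y, hY, rfl⟩
  exact (Real.sqrt_le_left (frob_nonneg _)).2 (h Y hY)

/-- If every distance to a point of `Ω` drops by `c` in square, so does the distance to `Ω`. -/
lemma mdist_sq_le_sub {a b : ℕ} {X X' : Matrix (Fin a) (Fin b) ℝ}
    {Ω : Set (Matrix (Fin a) (Fin b) ℝ)} (hne : Ω.Nonempty) {c : ℝ}
    (h : ∀ Y ∈ Ω, frob (X' - Y) ^ 2 ≤ frob (X - Y) ^ 2 - c) :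
    mdist X' Ω ^ 2 ≤ mdist X Ω ^ 2 - c := by
  rw [le_sub_iff_add_le]
  refine le_mdist_sq X hne fun Y hY => ?_
  have h₁ := pow_le_pow_left₀ (mdist_nonneg X' Ω) (mdist_le_frob X' hY) 2
  linarith [h Y hY]

lemma frob_sub_smul_sq {a b : ℕ} (D G : Matrix (Fin a) (Fin b) ℝ) (c : ℝ) :
    frob (D - c • G) ^ 2 =
      frob D ^ 2 - 2 * c * ∑ j, ∑ q, D j q * G j q + c ^ 2 * frob G ^ 2 := by
  simp only [frob_sq, Finset.mul_sum, ← Finset.sum_sub_distrib, ← Finset.sum_add_distrib,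
    Matrix.sub_apply, Matrix.smul_apply, smul_eq_mul]
  refine Finset.sum_congr rfl fun j _ => Finset.sum_congr rfl fun q _ => ?_
  ring

/-- Submultiplicativity of the Frobenius norm for the product of the transpose of a row block of
`A` with the same row block of `W`. -/
lemma sum_sq_sum_mul_le {m n p : ℕ} (τ : Finset (Fin m))
    (A : Matrix (Fin m) (Fin n) ℝ) (W : Matrix (Fin m) (Fin p) ℝ) :
    ∑ j, ∑ q, (∑ i ∈ τ, A i j * W i q) ^ 2 ≤
      (∑ i ∈ τ, ∑ j, A i j ^ 2) * ∑ i ∈ τ, ∑ q, W i q ^ 2 := by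
  rw [Finset.sum_comm (s := τ) (f := fun i j => A i j ^ 2),
    Finset.sum_comm (s := τ) (f := fun i q => W i q ^ 2), Finset.sum_mul_sum]
  gcongr
  exact Finset.sum_mul_sq_le_sq_mul_sq _ _ _

lemma sum_mul_sum_eq {m n p : ℕ} (τ : Finset (Fin m)) (A : Matrix (Fin m) (Fin n) ℝ)
    (W : Matrix (Fin m) (Fin p) ℝ) (D : Matrix (Fin n) (Fin p) ℝ) :
    ∑ j, ∑ q, D j q * ∑ i ∈ τ, A i j * W i q = ∑ i ∈ τ, ∑ q, (A * D) i q * W i q := by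
  simp only [Matrix.mul_apply, Finset.mul_sum, Finset.sum_mul]
  rw [Finset.sum_comm, Finset.sum_comm (s := τ)]
  refine Finset.sum_congr rfl fun q _ => ?_
  rw [Finset.sum_comm]
  refine Finset.sum_congr rfl fun i _ => Finset.sum_congr rfl fun j _ => ?_
  ring

lemma sq_max_zero_le_mul {x y : ℝ} (h : x ≤ y) : max x 0 ^ 2 ≤ y * max x 0 := by
  rcases le_total x 0 with hx | hx
  · simp [hx]
  · rw [max_eq_left hx]
    nlinarith

/-- One B-MRK step on a block of inequality constraints decreases the squared
distance to the feasible region. -/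
theorem bmrk_ineq_step {m n p : ℕ}
    (A : Matrix (Fin m) (Fin n) ℝ) (B : Matrix (Fin m) (Fin p) ℝ)
    (Ile Ieq : Finset (Fin m)) (hdisj : Disjoint Ile Ieq)
    (hunion : Ile ∪ Ieq = Finset.univ)
    (Ω : Set (Matrix (Fin n) (Fin p) ℝ))
    (hΩ : Ω = {X | (∀ i ∈ Ile, ∀ j, (A * X) i j ≤ B i j) ∧
                   (∀ i ∈ Ieq, ∀ j, (A * X) i j = B i j)})
    (hne : Ω.Nonempty)
    (τ : Finset (Fin m)) (hτ : τ ⊆ Ile)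
    (hAτ : 0 < ∑ i ∈ τ, ∑ j, (A i j) ^ 2)
    (t : ℝ) (ht : 0 ≤ t)
    (X Xp : Matrix (Fin n) (Fin p) ℝ)
    (hXp : ∀ j q, Xp j q =
      X j q - (t / ∑ i ∈ τ, ∑ j', (A i j') ^ 2) *
        ∑ i ∈ τ, A i j * max ((A * X - B) i q) 0) :
    mdist Xp Ω ^ 2 ≤ mdist X Ω ^ 2 -
      (2 * t / ∑ i ∈ τ, ∑ j, (A i j) ^ 2) * (1 - t / 2) *
        ∑ i ∈ τ, ∑ q, (max ((A * X - B) i q) 0) ^ 2 := by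
  refine mdist_sq_le_sub hne fun Y hY => ?_
  subst hΩ
  set s := ∑ i ∈ τ, ∑ j, (A i j) ^ 2
  let W : Matrix (Fin m) (Fin p) ℝ := fun i q => max ((A * X - B) i q) 0
  let G : Matrix (Fin n) (Fin p) ℝ := fun j q => ∑ i ∈ τ, A i j * W i q
  set w := ∑ i ∈ τ, ∑ q, (max ((A * X - B) i q) 0) ^ 2
  have hstep : Xp - Y = (X - Y) - (t / s) • G := by
    ext j q
    simp only [Matrix.sub_apply, Matrix.smul_apply, smul_eq_mul, hXp]
    exact sub_right_comm _ _ _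
  have hG : frob G ^ 2 ≤ s * w := (frob_sq G).trans_le (sum_sq_sum_mul_le τ A W)
  have hinner : w ≤ ∑ j, ∑ q, (X - Y) j q * G j q := by
    rw [sum_mul_sum_eq τ A W (X - Y)]
    refine Finset.sum_le_sum fun i hi => Finset.sum_le_sum fun q _ => sq_max_zero_le_mul ?_
    rw [Matrix.mul_sub, Matrix.sub_apply, Matrix.sub_apply]
    linarith [hY.1 i (hτ hi) q]
  have hc : 0 ≤ t / s := by positivity
  have h₁ := mul_le_mul_of_nonneg_left hinner (mul_nonneg zero_le_two hc)
  have h₂ := mul_le_mul_of_nonneg_left hG (sq_nonneg (t / s))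
  have h₃ : 2 * t / s * (1 - t / 2) * w = 2 * (t / s) * w - (t / s) ^ 2 * (s * w) := by
    field_simp
  rw [hstep, frob_sub_smul_sq, h₃]
  linarith
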